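/- Let β₀ > 0 and let r : I → ℝ^{𝒳̂} be a function on an open interval I around β₀ that is differentiable at β₀, such that for every β ∈ I, r(β) is a probability distribution on 𝒳̂ with BA_β[r(β)] = r(β), and r(β₀)(x̂) > 0 for every x̂. Let q := q[r(β₀)] be the encoder at parameter β₀ and set A_{x̂,x̂'} := ∑_x p_X(x)·q(x̂'|x)·q(x̂|x) / r(β₀)(x̂'). Then for every x̂ ∈ 𝒳̂: ∑_{x̂'} A_{x̂,x̂'} · (d r(x̂')/dβ)|_{β=β₀} = ∑_x ∑_{x̂'} p_X(x)·q(x̂'|x)·q(x̂|x)·d(x,x̂') − ∑_x p_X(x)·q(x̂|x)·d(x,x̂). -/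

import Mathlib

open scoped BigOperators

variable {X Xhat : Type*} [Fintype X] [Fintype Xhat]

/-- The partition function `Z(x, β) = ∑_{x̂'} r(x̂')·e^{−β d(x,x̂')}`. -/
noncomputable def Zf (d : X → Xhat → ℝ) (r : Xhat → ℝ) (β : ℝ) (x : X) : ℝ :=
  ∑ xh' : Xhat, r xh' * Real.exp (-β * d x xh')

/-- The encoder `q[r](x̂|x) = r(x̂)·e^{−β d(x,x̂)} / Z(x,β)`. -/
noncomputable def enc (d : X → Xhat → ℝ) (r : Xhat → ℝ) (β : ℝ) (xh : Xhat) (x : X) : ℝ :=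
  r xh * Real.exp (-β * d x xh) / Zf d r β x

/-- The Blahut–Arimoto iteration `BA_β[r](x̂) = ∑_x p_X(x)·q[r](x̂|x)`. -/
noncomputable def BA (p : X → ℝ) (d : X → Xhat → ℝ) (β : ℝ) (r : Xhat → ℝ) (xh : Xhat) : ℝ :=
  ∑ x : X, p x * enc d r β xh x

theorem Zf_pos {α : Type*} [Nonempty Xhat] (d : α → Xhat → ℝ) {r : Xhat → ℝ} (hr : ∀ xh, 0 < r xh)
    (β : ℝ) (x : α) : 0 < Zf d r β x :=
  Finset.sum_pos (fun xh _ => mul_pos (hr xh) (Real.exp_pos _)) Finset.univ_nonempty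

theorem hasDerivAt_mul_exp {f : ℝ → ℝ} {f' β₀ : ℝ} (hf : HasDerivAt f f' β₀) (c : ℝ) :
    HasDerivAt (fun β => f β * Real.exp (-β * c))
      (f' * Real.exp (-β₀ * c) - f β₀ * Real.exp (-β₀ * c) * c) β₀ := by
  refine (hf.fun_mul (((hasDerivAt_id' β₀).fun_neg.mul_const c).exp)).congr_deriv ?_
  ring

/-- The derivative of the partition function along a path of marginals. -/
theorem hasDerivAt_Zf {α : Type*} (d : α → Xhat → ℝ) {r : ℝ → Xhat → ℝ} {r' : Xhat → ℝ} {β₀ : ℝ}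
    (hr : ∀ xh, HasDerivAt (fun β => r β xh) (r' xh) β₀) (hpos : ∀ xh, 0 < r β₀ xh) (x : α)
    (hZ : Zf d (r β₀) β₀ x ≠ 0) :
    HasDerivAt (fun β => Zf d (r β) β x)
      (Zf d (r β₀) β₀ x * ∑ xh, enc d (r β₀) β₀ xh x * (r' xh / r β₀ xh - d x xh)) β₀ := by
  refine (HasDerivAt.fun_sum (u := Finset.univ)
    (fun xh _ => hasDerivAt_mul_exp (hr xh) (d x xh))).congr_deriv ?_
  rw [Finset.mul_sum]
  refine Finset.sum_congr rfl fun xh _ => ?_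
  have := (hpos xh).ne'
  unfold enc
  field_simp

/-- The derivative of the encoder along a path of marginals. -/
theorem hasDerivAt_enc {α : Type*} (d : α → Xhat → ℝ) {r : ℝ → Xhat → ℝ} {r' : Xhat → ℝ} {β₀ : ℝ}
    (hr : ∀ xh, HasDerivAt (fun β => r β xh) (r' xh) β₀) (hpos : ∀ xh, 0 < r β₀ xh) (x : α)
    (hZ : Zf d (r β₀) β₀ x ≠ 0) (xh : Xhat) :
    HasDerivAt (fun β => enc d (r β) β xh x)
      (enc d (r β₀) β₀ xh x * (r' xh / r β₀ xh - d x xh -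
        ∑ xh', enc d (r β₀) β₀ xh' x * (r' xh' / r β₀ xh' - d x xh'))) β₀ := by
  refine ((hasDerivAt_mul_exp (hr xh) (d x xh)).fun_div
    (hasDerivAt_Zf d hr hpos x hZ) hZ).congr_deriv ?_
  generalize ∑ xh', enc d (r β₀) β₀ xh' x * (r' xh' / r β₀ xh' - d x xh') = S
  have := (hpos xh).ne'
  unfold enc
  field_simp

/-- **The rate-distortion ODE** (Theorem `thm:beta-ODE-in-marginal-coords`): if `r(β)` is a
differentiable path of fully supported fixed points of `BA_β` on an open interval around
`β₀ > 0`, then, with `q := q[r(β₀)]` and `A_{x̂,x̂'} = ∑_x p(x)·q(x̂'|x)·q(x̂|x)/r(β₀)(x̂')`: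
`∑_{x̂'} A_{x̂,x̂'}·(dr(x̂')/dβ) = 𝔼_{q,p}[q(x̂|x)d(x,x̂')] − 𝔼_p[q(x̂|x)d(x,x̂)]`. -/
theorem rdODE (p : X → ℝ) (hp0 : ∀ x, 0 ≤ p x) (hp1 : ∑ x, p x = 1)
    (d : X → Xhat → ℝ) (β₀ : ℝ) (hβ₀ : 0 < β₀) (a b : ℝ)
    (r : ℝ → Xhat → ℝ) (hmem : β₀ ∈ Set.Ioo a b)
    (hdiff : DifferentiableAt ℝ r β₀)
    (hfix : ∀ β ∈ Set.Ioo a b, (∀ xh, 0 ≤ r β xh) ∧ (∑ xh, r β xh = 1) ∧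
      ∀ xh, BA p d β (r β) xh = r β xh)
    (hpos : ∀ xh, 0 < r β₀ xh) :
    ∀ xh : Xhat,
      (∑ xh', (∑ x, p x * enc d (r β₀) β₀ xh' x * enc d (r β₀) β₀ xh x / r β₀ xh') *
          deriv (fun β => r β xh') β₀) =
        (∑ x, ∑ xh', p x * enc d (r β₀) β₀ xh' x * enc d (r β₀) β₀ xh x * d x xh') -
          ∑ x, p x * enc d (r β₀) β₀ xh x * d x xh := by
  intro xh
  have : Nonempty Xhat := ⟨xh⟩
  have hr : ∀ xh', HasDerivAt (fun β => r β xh') (deriv (fun β => r β xh') β₀) β₀ :=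
    fun xh' => (differentiableAt_pi.1 hdiff xh').hasDerivAt
  generalize hr' : (fun xh' => deriv (fun β => r β xh') β₀) = r'
  simp only [funext_iff] at hr'
  simp only [hr'] at hr ⊢
  have hBA : HasDerivAt (fun β => BA p d β (r β) xh) _ β₀ :=
    HasDerivAt.fun_sum (u := Finset.univ) fun x _ =>
      (hasDerivAt_enc d hr hpos x (Zf_pos d hpos β₀ x).ne' xh).const_mul (p x)
  have hev : (fun β => r β xh) =ᶠ[nhds β₀] fun β => BA p d β (r β) xh := by
    filter_upwards [Ioo_mem_nhds hmem.1 hmem.2] with β hβ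
    exact ((hfix β hβ).2.2 xh).symm
  have key := (hr xh).unique (hBA.congr_of_eventuallyEq hev)
  have hmain : ∑ x, p x * enc d (r β₀) β₀ xh x * (r' xh / r β₀ xh) = r' xh := by
    have hfix₀ := (hfix β₀ hmem).2.2 xh
    unfold BA at hfix₀
    rw [← Finset.sum_mul, hfix₀, mul_div_cancel₀ _ (hpos xh).ne']
  have hA : ∑ xh', (∑ x, p x * enc d (r β₀) β₀ xh' x * enc d (r β₀) β₀ xh x / r β₀ xh') * r' xh' =
      ∑ x, ∑ xh', p x * enc d (r β₀) β₀ xh' x * enc d (r β₀) β₀ xh x / r β₀ xh' * r' xh' := by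
    simp only [Finset.sum_mul]
    exact Finset.sum_comm
  have hsplit : ∑ x, p x * (enc d (r β₀) β₀ xh x * (r' xh / r β₀ xh - d x xh -
        ∑ xh', enc d (r β₀) β₀ xh' x * (r' xh' / r β₀ xh' - d x xh'))) =
      ∑ x, p x * enc d (r β₀) β₀ xh x * (r' xh / r β₀ xh) -
        ∑ x, p x * enc d (r β₀) β₀ xh x * d x xh -
        (∑ x, ∑ xh', p x * enc d (r β₀) β₀ xh' x * enc d (r β₀) β₀ xh x / r β₀ xh' * r' xh' -
          ∑ x, ∑ xh', p x * enc d (r β₀) β₀ xh' x * enc d (r β₀) β₀ xh x * d x xh') := by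
    simp only [← Finset.sum_sub_distrib]
    refine Finset.sum_congr rfl fun x _ => ?_
    rw [mul_sub, mul_sub, Finset.mul_sum, Finset.mul_sum]
    congr 1
    · ring
    · exact Finset.sum_congr rfl fun xh' _ => by ring
  rw [hA]
  linarith
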